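/- Let Ω ⊆ ℝ^{n+1} be an open set whose boundary ∂Ω is n-dimensional Ahlfors–David regular. Suppose u ≥ 0 is harmonic in Ω ∩ B(x,2r), continuous on the closure of Ω ∩ B(x,2r), and vanishes identically on the surface ball Δ(x,2r) := B(x,2r) ∩ ∂Ω, where x ∈ ∂Ω and 0 < r < diam(∂Ω). Then there are constants C > 0 and α ∈ (0,1], depending only on the dimension and the ADR constant of ∂Ω, such that u(Y) ≤ C (δ(Y)/r)^α · |B(x,2r)|^{-1} ∬_{B(x,2r)∩Ω} u(Z) dZ for every Y ∈ B(x,r) ∩ Ω, where δ(Y) := dist(Y, ∂Ω) and |B(x,2r)| is the Lebesgue measure of the ball. -/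

import Mathlib

open MeasureTheory Metric Set
open scoped ENNReal NNReal InnerProductSpace

noncomputable section

abbrev ES (n : ℕ) : Type := EuclideanSpace ℝ (Fin (n + 1))

/-- `E ⊆ ℝ^{n+1}` is `n`-dimensional Ahlfors–David regular with constant `C`. -/
def IsADR (n : ℕ) (C : ℝ) (E : Set (ES n)) : Prop :=
  IsClosed E ∧ 1 ≤ C ∧
    ∀ x ∈ E, ∀ r : ℝ, 0 < r → ENNReal.ofReal r < EMetric.diam E →
      ENNReal.ofReal (C⁻¹ * r ^ n) ≤ μH[(n : ℝ)] (E ∩ ball x r) ∧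
      μH[(n : ℝ)] (E ∩ ball x r) ≤ ENNReal.ofReal (C * r ^ n)

/-- Harmonic: twice continuously differentiable with vanishing Laplacian. -/
def HarmonicOn {n : ℕ} (u : ES n → ℝ) (U : Set (ES n)) : Prop :=
  ContDiffOn ℝ 2 u U ∧ ∀ x ∈ U,
    ∑ i : Fin (n + 1),
      fderiv ℝ (fun y => fderiv ℝ u y (EuclideanSpace.single i 1)) x
        (EuclideanSpace.single i 1) = 0

/-- The primitive of `Real.smoothTransition` vanishing at `0`: a smooth convex function that
vanishes on `(-∞, 0]`. -/
def ramp (t : ℝ) : ℝ := ∫ s in (0 : ℝ)..t, Real.smoothTransition s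

lemma hasDerivAt_ramp (t : ℝ) : HasDerivAt ramp (Real.smoothTransition t) t :=
  Real.smoothTransition.continuous.integral_hasStrictDerivAt 0 t |>.hasDerivAt

lemma deriv_ramp : deriv ramp = Real.smoothTransition :=
  funext fun t => (hasDerivAt_ramp t).deriv

lemma contDiff_ramp : ContDiff ℝ 2 ramp := by
  have h : ContDiff ℝ (⊤ : ℕ∞) ramp := by
    rw [contDiff_infty_iff_deriv, deriv_ramp]
    exact ⟨fun t => (hasDerivAt_ramp t).differentiableAt, Real.smoothTransition.contDiff⟩
  exact contDiff_infty.1 h 2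

lemma ramp_of_nonpos {t : ℝ} (ht : t ≤ 0) : ramp t = 0 := by
  unfold ramp
  rw [intervalIntegral.integral_congr (g := fun _ => (0 : ℝ)), intervalIntegral.integral_zero]
  intro s hs
  rw [uIcc_of_ge ht] at hs
  exact Real.smoothTransition.zero_of_nonpos hs.2

lemma monotone_ramp : Monotone ramp :=
  monotone_of_deriv_nonneg (fun t => (hasDerivAt_ramp t).differentiableAt) fun t => by
    rw [deriv_ramp]; exact Real.smoothTransition.nonneg t

lemma ramp_nonneg (t : ℝ) : 0 ≤ ramp t := by
  rcases le_total t 0 with h | h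
  · exact (ramp_of_nonpos h).ge
  · exact (ramp_of_nonpos le_rfl).ge.trans (monotone_ramp h)

lemma ramp_le_self {t : ℝ} (ht : 0 ≤ t) : ramp t ≤ t := by
  have h : Monotone fun t => t - ramp t := by
    have hd (t : ℝ) : HasDerivAt (fun t => t - ramp t) (1 - Real.smoothTransition t) t :=
      (hasDerivAt_id t).sub (hasDerivAt_ramp t)
    refine monotone_of_deriv_nonneg (fun t => (hd t).differentiableAt) fun t => ?_
    rw [(hd t).deriv]
    exact sub_nonneg.2 (Real.smoothTransition.le_one t)
  have := h ht
  simp only [ramp_of_nonpos le_rfl] at this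
  linarith

lemma sub_one_le_ramp (t : ℝ) : t - 1 ≤ ramp t := by
  rcases le_total t 1 with h | h
  · linarith [ramp_nonneg t]
  · have hd (t : ℝ) : HasDerivAt (fun t => ramp t - t) (Real.smoothTransition t - 1) t :=
      (hasDerivAt_ramp t).sub (hasDerivAt_id t)
    have hm : MonotoneOn (fun t => ramp t - t) (Ici 1) := by
      refine monotoneOn_of_deriv_nonneg (convex_Ici 1)
        (fun t _ => (hd t).continuousAt.continuousWithinAt)
        (fun t _ => (hd t).differentiableAt.differentiableWithinAt) fun t ht => ?_
      rw [interior_Ici] at ht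
      rw [(hd t).deriv, Real.smoothTransition.one_of_one_le (mem_Ioi.1 ht).le, sub_self]
    have := hm self_mem_Ici h h
    simp only at this
    linarith [ramp_nonneg 1]

lemma ramp_pos {t : ℝ} (ht : 0 < t) : 0 < ramp t := by
  refine intervalIntegral.intervalIntegral_pos_of_pos_on
    (Real.smoothTransition.continuous.intervalIntegrable _ _) ?_ ht
  exact fun s hs => Real.smoothTransition.pos_of_pos hs.1

variable {n : ℕ}

/-- A nonnegative radial function supported in the unit ball. -/
def bump (z : ES n) : ℝ := ramp (1 - ‖z‖ ^ 2)

/-- The radial kernel supported in the unit ball with `meanKernel z • z = -∇ bump z`. -/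
def meanKernel (z : ES n) : ℝ := 2 * Real.smoothTransition (1 - ‖z‖ ^ 2)

/-- The Laplacian, written with iterated partial derivatives. -/
def lap (V : ES n → ℝ) (p : ES n) : ℝ :=
  ∑ i : Fin (n + 1), fderiv ℝ (fun y => fderiv ℝ V y (EuclideanSpace.single i 1)) p
    (EuclideanSpace.single i 1)

/-- Weighted mean of `V` over the ball of radius `s` centred at `p`. -/
def kernelMean (V : ES n → ℝ) (p : ES n) (s : ℝ) : ℝ :=
  ∫ z in closedBall (0 : ES n) 1, V (p + s • z) * meanKernel z

lemma continuous_meanKernel : Continuous (meanKernel : ES n → ℝ) :=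
  continuous_const.mul (Real.smoothTransition.continuous.comp (by fun_prop))

lemma contDiff_bump : ContDiff ℝ 2 (bump : ES n → ℝ) :=
  contDiff_ramp.comp (contDiff_const.sub (contDiff_norm_sq ℝ))

lemma continuous_bump : Continuous (bump : ES n → ℝ) := contDiff_bump.continuous

lemma meanKernel_nonneg (z : ES n) : 0 ≤ meanKernel z :=
  mul_nonneg zero_le_two (Real.smoothTransition.nonneg _)

lemma meanKernel_le_two (z : ES n) : meanKernel z ≤ 2 := by
  have := Real.smoothTransition.le_one (1 - ‖z‖ ^ 2)
  unfold meanKernel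
  linarith

lemma bump_nonneg (z : ES n) : 0 ≤ bump z := ramp_nonneg _

lemma bump_le_one (z : ES n) : bump z ≤ 1 := by
  calc bump z ≤ ramp 1 := monotone_ramp (by nlinarith [sq_nonneg ‖z‖])
    _ ≤ 1 := ramp_le_self zero_le_one

lemma bump_eq_zero {z : ES n} (hz : 1 ≤ ‖z‖) : bump z = 0 :=
  ramp_of_nonpos (by nlinarith)

lemma meanKernel_eq_zero {z : ES n} (hz : 1 ≤ ‖z‖) : meanKernel z = 0 := by
  rw [meanKernel, Real.smoothTransition.zero_of_nonpos (by nlinarith), mul_zero]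

lemma hasCompactSupport_bump : HasCompactSupport (bump : ES n → ℝ) :=
  HasCompactSupport.intro (isCompact_closedBall 0 1) fun z hz => bump_eq_zero (by
    simp only [mem_closedBall, dist_zero_right, not_le] at hz; exact hz.le)

lemma fderiv_bump (z v : ES n) : fderiv ℝ bump z v = -(meanKernel z * inner ℝ z v) := by
  have h : HasFDerivAt (bump : ES n → ℝ)
      (Real.smoothTransition (1 - ‖z‖ ^ 2) • -((2 : ℕ) • (innerSL ℝ z : ES n →L[ℝ] ℝ))) z :=
    (hasDerivAt_ramp _).comp_hasFDerivAt z
      ((hasStrictFDerivAt_norm_sq z).hasFDerivAt.const_sub 1)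
  rw [h.fderiv]
  simp [meanKernel]
  ring

lemma contDiff_partial {V : ES n → ℝ} (hV : ContDiff ℝ 2 V) (v : ES n) :
    ContDiff ℝ 1 fun y => fderiv ℝ V y v :=
  (hV.fderiv_right (m := 1) (by norm_num)).clm_apply contDiff_const

lemma continuous_lap {V : ES n → ℝ} (hV : ContDiff ℝ 2 V) : Continuous (lap V) := by
  unfold lap
  refine continuous_finsetSum _ fun i _ => ?_
  exact ((contDiff_partial hV _).continuous_fderiv one_ne_zero).clm_apply continuous_const

/-- Integration by parts turning the radial derivative of the kernel mean into a weighted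
integral of the Laplacian. -/
lemma integral_fderiv_mul_meanKernel {V : ES n → ℝ} (hV : ContDiff ℝ 2 V) (p : ES n) (s : ℝ) :
    ∫ z in closedBall (0 : ES n) 1, fderiv ℝ V (p + s • z) z * meanKernel z =
      s * ∫ z in closedBall (0 : ES n) 1, lap V (p + s • z) * bump z := by
  have houts {z : ES n} (hz : z ∉ closedBall (0 : ES n) 1) : 1 ≤ ‖z‖ := by
    simp only [mem_closedBall, dist_zero_right, not_le] at hz; exact hz.le
  rw [setIntegral_eq_integral_of_forall_compl_eq_zero fun z hz => by
      rw [meanKernel_eq_zero (houts hz), mul_zero],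
    setIntegral_eq_integral_of_forall_compl_eq_zero fun z hz => by
      rw [bump_eq_zero (houts hz), mul_zero]]
  let e (i : Fin (n + 1)) : ES n := EuclideanSpace.single i 1
  let g (i : Fin (n + 1)) (z : ES n) : ℝ := fderiv ℝ V (p + s • z) (e i)
  have hg (i) : ContDiff ℝ 1 (g i) :=
    (contDiff_partial hV (e i)).comp (contDiff_const.add (contDiff_id.const_smul s))
  have hg' (i) (z : ES n) : fderiv ℝ (g i) z (e i) =
      s * fderiv ℝ (fun y => fderiv ℝ V y (e i)) (p + s • z) (e i) := by
    have h1 : HasFDerivAt (fun z : ES n => p + s • z) (s • ContinuousLinearMap.id ℝ (ES n)) z :=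
      ((hasFDerivAt_id z).const_smul s).const_add p
    have h2 := ((contDiff_partial hV (e i)).differentiable one_ne_zero (p + s • z)).hasFDerivAt
    rw [show g i = (fun y => fderiv ℝ V y (e i)) ∘ (fun z : ES n => p + s • z) from rfl,
      (h2.comp z h1).fderiv]
    simp
  have hbc := contDiff_bump (n := n)
  have hfb (i) : Continuous fun z => fderiv ℝ (bump : ES n → ℝ) z (e i) :=
    (contDiff_partial hbc (e i)).continuous
  have hfg (i) : Continuous fun z => fderiv ℝ (g i) z (e i) :=
    ((hg i).continuous_fderiv one_ne_zero).clm_apply continuous_const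
  have hI1 (i) : Integrable fun z => g i z * fderiv ℝ bump z (e i) :=
    ((hg i).continuous.mul (hfb i)).integrable_of_hasCompactSupport
      ((hasCompactSupport_bump.fderiv_apply ℝ (e i)).mul_left)
  have hI2 (i) : Integrable fun z => fderiv ℝ (g i) z (e i) * bump z :=
    ((hfg i).mul continuous_bump).integrable_of_hasCompactSupport
      hasCompactSupport_bump.mul_left
  have hI3 (i) : Integrable fun z => g i z * bump z :=
    ((hg i).continuous.mul continuous_bump).integrable_of_hasCompactSupport
      hasCompactSupport_bump.mul_left
  have hparts (i) : ∫ z, g i z * fderiv ℝ bump z (e i) = -∫ z, fderiv ℝ (g i) z (e i) * bump z :=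
    integral_mul_fderiv_eq_neg_fderiv_mul_of_integrable (hI2 i) (hI1 i) (hI3 i)
      (fun z _ => (hg i).differentiable one_ne_zero z)
      (fun z _ => hbc.differentiable two_ne_zero z)
  have hl (z : ES n) : fderiv ℝ V (p + s • z) z * meanKernel z =
      ∑ i, -(g i z * fderiv ℝ bump z (e i)) := by
    have hz : z = ∑ i, z i • e i := by
      ext j
      simp [e, Finset.sum_apply, Pi.single_apply]
    have : fderiv ℝ V (p + s • z) z = ∑ i, z i * g i z := by
      conv_lhs => rw [hz, map_sum]
      simp only [map_smul, smul_eq_mul]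
      rw [← hz]
    rw [this, Finset.sum_mul]
    refine Finset.sum_congr rfl fun i _ => ?_
    have : inner ℝ z (e i) = z i := by simp [e, EuclideanSpace.inner_single_right]
    rw [fderiv_bump, this]
    ring
  have hr (z : ES n) : s * (lap V (p + s • z) * bump z) =
      ∑ i, fderiv ℝ (g i) z (e i) * bump z := by
    simp only [hg', lap, Finset.sum_mul, Finset.mul_sum, e, mul_assoc]
  rw [← integral_const_mul]
  simp only [hl, hr]
  rw [integral_finsetSum _ fun i _ => hI2 i,
    integral_finsetSum (f := fun i z => -(g i z * fderiv ℝ bump z (e i))) _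
      fun i _ => (hI1 i).neg]
  refine Finset.sum_congr rfl fun i _ => ?_
  rw [integral_neg, hparts, neg_neg]

lemma hasDerivAt_kernelMean {V : ES n → ℝ} (hV : ContDiff ℝ 2 V) (p : ES n) (s : ℝ) :
    HasDerivAt (kernelMean V p)
      (s * ∫ z in closedBall (0 : ES n) 1, lap V (p + s • z) * bump z) s := by
  rw [← integral_fderiv_mul_meanKernel hV]
  have hd : Continuous fun q : ℝ × ES n => fderiv ℝ V (p + q.1 • q.2) q.2 * meanKernel q.2 := by
    have h1 := hV.continuous_fderiv two_ne_zero
    have h2 := continuous_meanKernel (n := n)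
    fun_prop
  have hVc := hV.continuous
  have hmk := continuous_meanKernel (n := n)
  obtain ⟨M, hM⟩ := ((isCompact_closedBall s 1).prod
    (isCompact_closedBall (0 : ES n) 1)).exists_bound_of_continuousOn hd.continuousOn
  have hfin : volume (closedBall (0 : ES n) 1) < ∞ := measure_closedBall_lt_top
  refine (hasDerivAt_integral_of_dominated_loc_of_deriv_le (𝕜 := ℝ) (bound := fun _ => M)
    (F := fun t z => V (p + t • z) * meanKernel z)
    (F' := fun t z => fderiv ℝ V (p + t • z) z * meanKernel z)
    (closedBall_mem_nhds s one_pos) ?_ ?_ ?_ ?_ ?_ ?_).2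
  · exact Filter.Eventually.of_forall fun t =>
      (show Continuous fun z => V (p + t • z) * meanKernel z by fun_prop).aestronglyMeasurable
  · exact (show Continuous fun z => V (p + s • z) * meanKernel z by
      fun_prop).continuousOn.integrableOn_compact (isCompact_closedBall _ _)
  · exact (hd.comp (Continuous.prodMk_right s)).aestronglyMeasurable
  · exact (ae_restrict_iff' measurableSet_closedBall).2
      (Filter.Eventually.of_forall fun z hz t ht => hM (t, z) ⟨ht, hz⟩)
  · exact integrableOn_const hfin.ne
  · refine Filter.Eventually.of_forall fun z t _ => ?_
    have h1 : HasDerivAt (fun t : ℝ => p + t • z) z t := by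
      simpa using ((hasDerivAt_id t).smul_const z).const_add p
    exact ((hV.differentiable two_ne_zero _).hasFDerivAt.comp_hasDerivAt t h1).mul_const _

lemma continuous_integral_lap_mul_bump {V : ES n → ℝ} (hV : ContDiff ℝ 2 V) (p : ES n) :
    Continuous fun s : ℝ => s * ∫ z in closedBall (0 : ES n) 1, lap V (p + s • z) * bump z := by
  refine continuous_id.mul (continuous_parametric_integral_of_continuous
    (f := fun (s : ℝ) z => lap V (p + s • z) * bump z) ?_ (isCompact_closedBall _ _))
  have h1 := continuous_lap hV
  have h2 := continuous_bump (n := n)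
  simp only [Function.uncurry_def]
  fun_prop

/-- The total mass of `meanKernel`. -/
def kernelMass (n : ℕ) : ℝ := ∫ z in closedBall (0 : ES n) 1, meanKernel z

lemma integrableOn_meanKernel : IntegrableOn (meanKernel : ES n → ℝ) (closedBall 0 1) :=
  continuous_meanKernel.continuousOn.integrableOn_compact (isCompact_closedBall _ _)

lemma kernelMass_pos (n : ℕ) : 0 < kernelMass n := by
  unfold kernelMass
  rw [setIntegral_eq_integral_of_forall_compl_eq_zero fun z hz => meanKernel_eq_zero (by
    simp only [mem_closedBall, dist_zero_right, not_le] at hz; exact hz.le)]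
  refine continuous_meanKernel.integral_pos_of_hasCompactSupport_nonneg_nonzero
    (HasCompactSupport.intro (isCompact_closedBall 0 1) fun z hz => meanKernel_eq_zero (by
      simp only [mem_closedBall, dist_zero_right, not_le] at hz; exact hz.le))
    meanKernel_nonneg (x := 0) ?_
  simp [meanKernel, Real.smoothTransition.one_of_one_le]

/-- Mean value formula with a remainder given by the Laplacian. -/
lemma kernelMean_eq_add_integral_lap {V : ES n → ℝ} (hV : ContDiff ℝ 2 V) (p : ES n) (R : ℝ) :
    kernelMean V p R = kernelMass n * V p +
      ∫ s in (0 : ℝ)..R, s * ∫ z in closedBall (0 : ES n) 1, lap V (p + s • z) * bump z := by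
  rw [intervalIntegral.integral_eq_sub_of_hasDerivAt
    (fun s _ => hasDerivAt_kernelMean hV p s)
    ((continuous_integral_lap_mul_bump hV p).intervalIntegrable _ _)]
  have : kernelMean V p 0 = kernelMass n * V p := by
    simp only [kernelMean, zero_smul, add_zero, integral_const_mul, kernelMass]
    ring
  rw [this]; ring

lemma setIntegral_closedBall_comp_smul (F : ES n → ℝ) (p : ES n) {s t : ℝ} (hs : 0 < s)
    (ht : 0 ≤ t) :
    ∫ z in closedBall (0 : ES n) t, F (p + s • z) =
      (s ^ (n + 1))⁻¹ * ∫ q in closedBall p (s * t), F q := by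
  rw [Measure.setIntegral_comp_smul_of_pos volume (fun q => F (p + q)) _ hs,
    smul_closedBall _ _ ht, smul_zero, finrank_euclideanSpace_fin, smul_eq_mul,
    Real.norm_of_nonneg hs.le]
  congr 1
  rw [← integral_indicator measurableSet_closedBall, ← integral_indicator measurableSet_closedBall,
    ← integral_add_left_eq_self ((closedBall p (s * t)).indicator F) p]
  congr 1
  ext q
  simp [indicator]

lemma integrableOn_closedBall_of_continuous {F : ES n → ℝ} (hF : Continuous F) (p : ES n) (s : ℝ) :
    IntegrableOn F (closedBall p s) :=
  hF.continuousOn.integrableOn_compact (isCompact_closedBall _ _)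

lemma add_smul_mem_closedBall {p z : ES n} {s t : ℝ} (hs : 0 ≤ s)
    (hz : z ∈ closedBall (0 : ES n) t) : p + s • z ∈ closedBall p (s * t) := by
  rw [mem_closedBall, dist_zero_right] at hz
  rw [mem_closedBall, dist_eq_norm, add_sub_cancel_left, norm_smul, Real.norm_of_nonneg hs]
  exact mul_le_mul_of_nonneg_left hz hs

lemma integral_comp_smul_mul_le {F k : ES n → ℝ} (hF : Continuous F) (hk : Continuous k)
    {p : ES n} {s M : ℝ} (hs : 0 < s) (hpos : ∀ q ∈ closedBall p s, 0 ≤ F q) (hM : ∀ z, k z ≤ M) :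
    ∫ z in closedBall (0 : ES n) 1, F (p + s • z) * k z ≤
      M * ((s ^ (n + 1))⁻¹ * ∫ q in closedBall p s, F q) := by
  have h := setIntegral_closedBall_comp_smul F p hs zero_le_one
  rw [mul_one] at h
  rw [← h, ← integral_const_mul]
  have h1 : Continuous fun z => F (p + s • z) * k z := by fun_prop
  have h2 : Continuous fun z => M * F (p + s • z) := by fun_prop
  refine setIntegral_mono_on (integrableOn_closedBall_of_continuous h1 _ _)
    (integrableOn_closedBall_of_continuous h2 _ _) measurableSet_closedBall fun z hz => ?_
  have hz' := add_smul_mem_closedBall (p := p) hs.le hz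
  rw [mul_one] at hz'
  rw [mul_comm]
  exact mul_le_mul_of_nonneg_right (hM z) (hpos _ hz')

lemma le_integral_comp_smul_mul {F k : ES n → ℝ} (hF : Continuous F) (hk : Continuous k)
    {p : ES n} {s t c : ℝ} (hs : 0 < s) (ht : 0 ≤ t) (ht1 : t ≤ 1)
    (hpos : ∀ q ∈ closedBall p s, 0 ≤ F q) (hk0 : ∀ z, 0 ≤ k z)
    (hc : ∀ z ∈ closedBall (0 : ES n) t, c ≤ k z) :
    c * ((s ^ (n + 1))⁻¹ * ∫ q in closedBall p (s * t), F q) ≤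
      ∫ z in closedBall (0 : ES n) 1, F (p + s • z) * k z := by
  have hpos' (z) (hz : z ∈ closedBall (0 : ES n) 1) : 0 ≤ F (p + s • z) :=
    hpos _ (by simpa using add_smul_mem_closedBall (p := p) hs.le hz)
  have h1 : Continuous fun z => F (p + s • z) * k z := by fun_prop
  have h2 : Continuous fun z => c * F (p + s • z) := by fun_prop
  rw [← setIntegral_closedBall_comp_smul F p hs ht, ← integral_const_mul]
  calc ∫ z in closedBall (0 : ES n) t, c * F (p + s • z)
      ≤ ∫ z in closedBall (0 : ES n) t, F (p + s • z) * k z := by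
        refine setIntegral_mono_on (integrableOn_closedBall_of_continuous h2 _ _)
          (integrableOn_closedBall_of_continuous h1 _ _) measurableSet_closedBall fun z hz => ?_
        rw [mul_comm]
        exact mul_le_mul_of_nonneg_left (hc z hz)
          (hpos' z (closedBall_subset_closedBall ht1 hz))
    _ ≤ _ := by
        refine setIntegral_mono_set (integrableOn_closedBall_of_continuous h1 _ _) ?_
          (closedBall_subset_closedBall ht1).eventuallyLE
        exact (ae_restrict_iff' measurableSet_closedBall).2
          (Filter.Eventually.of_forall fun z hz => mul_nonneg (hpos' z hz) (hk0 z))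

/-- The Laplacian term in the mean value formula. -/
def lapRemainder (V : ES n → ℝ) (p : ES n) (R : ℝ) : ℝ :=
  ∫ s in (0 : ℝ)..R, s * ∫ z in closedBall (0 : ES n) 1, lap V (p + s • z) * bump z

lemma lapRemainder_integrand_nonneg {V : ES n → ℝ} {p : ES n} {R s : ℝ}
    (hD : ∀ q ∈ closedBall p R, 0 ≤ lap V q) (hs : 0 ≤ s) (hsR : s ≤ R) :
    0 ≤ s * ∫ z in closedBall (0 : ES n) 1, lap V (p + s • z) * bump z := by
  refine mul_nonneg hs (setIntegral_nonneg measurableSet_closedBall fun z hz => ?_)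
  refine mul_nonneg (hD _ ?_) (bump_nonneg z)
  exact closedBall_subset_closedBall (by simpa using hsR) (add_smul_mem_closedBall hs hz)

/-- Local boundedness of nonnegative subharmonic functions. -/
lemma kernelMass_mul_le_integral {V : ES n → ℝ} (hV : ContDiff ℝ 2 V) {p : ES n} {R : ℝ}
    (hR : 0 < R) (hD : ∀ q ∈ closedBall p R, 0 ≤ lap V q) (hpos : ∀ q ∈ closedBall p R, 0 ≤ V q) :
    kernelMass n * V p ≤ 2 * ((R ^ (n + 1))⁻¹ * ∫ q in closedBall p R, V q) := by
  have h1 := kernelMean_eq_add_integral_lap hV p R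
  have h2 : 0 ≤ ∫ s in (0 : ℝ)..R,
      s * ∫ z in closedBall (0 : ES n) 1, lap V (p + s • z) * bump z :=
    intervalIntegral.integral_nonneg hR.le
      fun s hs => lapRemainder_integrand_nonneg hD hs.1 hs.2
  have h3 : kernelMean V p R ≤ _ := integral_comp_smul_mul_le hV.continuous
    continuous_meanKernel hR hpos meanKernel_le_two
  linarith

lemma ofReal_lapRemainder_le {V : ES n → ℝ} (hV : ContDiff ℝ 2 V) {z₀ w : ES n} {ρ : ℝ}
    (hρ : 0 < ρ) (hD : ∀ q ∈ closedBall z₀ (2 * ρ), 0 ≤ lap V q) (hw : w ∈ ball z₀ ρ) :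
    ENNReal.ofReal (lapRemainder V w ρ) ≤
      ∫⁻ s in Ioc 0 ρ, ∫⁻ p in closedBall z₀ (2 * ρ),
        {q : ES n | dist q w ≤ s}.indicator
          (fun q => ENNReal.ofReal ((s ^ n)⁻¹ * lap V q)) p := by
  have hsub (s) (hs : s ≤ ρ) : closedBall w s ⊆ closedBall z₀ (2 * ρ) :=
    closedBall_subset_closedBall' (by rw [mem_ball] at hw; linarith)
  have hD' (q) (hq : q ∈ closedBall w ρ) : 0 ≤ lap V q := hD q (hsub ρ le_rfl hq)
  have hlc := continuous_lap hV
  unfold lapRemainder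
  rw [intervalIntegral.integral_of_le hρ.le, ofReal_integral_eq_lintegral_ofReal]
  rotate_left
  · exact ((continuous_integral_lap_mul_bump hV w).intervalIntegrable _ _).1
  · exact (ae_restrict_iff' measurableSet_Ioc).2 (Filter.Eventually.of_forall
      fun s hs => lapRemainder_integrand_nonneg hD' hs.1.le hs.2)
  refine setLIntegral_mono' measurableSet_Ioc fun s hs => ?_
  have hsD (q) (hq : q ∈ closedBall w s) : 0 ≤ lap V q :=
    hD' q (closedBall_subset_closedBall hs.2 hq)
  have hle : s * ∫ z in closedBall (0 : ES n) 1, lap V (w + s • z) * bump z ≤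
      ∫ q in closedBall w s, (s ^ n)⁻¹ * lap V q := by
    rw [integral_const_mul]
    have := mul_le_mul_of_nonneg_left (integral_comp_smul_mul_le hlc continuous_bump hs.1 hsD
      bump_le_one) hs.1.le
    refine this.trans_eq ?_
    have := hs.1.ne'
    field_simp
    ring
  refine (ENNReal.ofReal_le_ofReal hle).trans ?_
  rw [ofReal_integral_eq_lintegral_ofReal
    (integrableOn_closedBall_of_continuous (by fun_prop) _ _)
    ((ae_restrict_iff' measurableSet_closedBall).2 (Filter.Eventually.of_forall
      fun q hq => mul_nonneg (inv_nonneg.2 (pow_nonneg hs.1.le _)) (hsD q hq)))]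
  rw [show {q : ES n | dist q w ≤ s} = closedBall w s from rfl,
    lintegral_indicator measurableSet_closedBall, Measure.restrict_restrict measurableSet_closedBall,
    inter_eq_left.2 (hsub s hs.2)]

/-- If `σ` has growth of order `n`, then a lower bound on the Laplacian remainders on the support
of `σ` gives a lower bound on the total Laplacian. -/
lemma mul_measure_le_integral_lap {V : ES n → ℝ} (hV : ContDiff ℝ 2 V) {z₀ : ES n} {ρ M A : ℝ}
    (hρ : 0 < ρ) (hM : 0 ≤ M) (hD : ∀ q ∈ closedBall z₀ (2 * ρ), 0 ≤ lap V q)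
    (σ : Measure (ES n)) [IsFiniteMeasure σ]
    (hgrowth : ∀ p : ES n, ∀ s, 0 < s → s ≤ ρ → σ (closedBall p s) ≤ ENNReal.ofReal (M * s ^ n))
    (hA : ∀ᵐ w ∂σ, w ∈ ball z₀ ρ ∧ A ≤ lapRemainder V w ρ) :
    ENNReal.ofReal A * σ univ ≤
      ENNReal.ofReal (M * ρ * ∫ q in closedBall z₀ (2 * ρ), lap V q) := by
  have hlc := continuous_lap hV
  let K : ES n × ℝ × ES n → ℝ≥0∞ :=
    {q : ES n × ℝ × ES n | dist q.2.2 q.1 ≤ q.2.1}.indicator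
      fun q => ENNReal.ofReal ((q.2.1 ^ n)⁻¹ * lap V q.2.2)
  have hK : Measurable K := by
    refine Measurable.indicator ?_ (isClosed_le (by fun_prop) (by fun_prop)).measurableSet
    have : Measurable fun q : ES n × ℝ × ES n => lap V q.2.2 :=
      (hlc.comp (by fun_prop)).measurable
    fun_prop
  let B := closedBall z₀ (2 * ρ)
  calc ENNReal.ofReal A * σ univ = ∫⁻ _, ENNReal.ofReal A ∂σ := by simp
    _ ≤ ∫⁻ w, ∫⁻ s in Ioc 0 ρ, ∫⁻ p in B, K (w, s, p) ∂volume ∂volume ∂σ := by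
        refine lintegral_mono_ae (hA.mono fun w hw => ?_)
        exact (ENNReal.ofReal_le_ofReal hw.2).trans (ofReal_lapRemainder_le hV hρ hD hw.1)
    _ = ∫⁻ s in Ioc 0 ρ, ∫⁻ w, ∫⁻ p in B, K (w, s, p) ∂volume ∂σ := by
        refine lintegral_lintegral_swap (Measurable.aemeasurable ?_)
        have : Measurable fun q : (ES n × ℝ) × ES n => K (q.1.1, q.1.2, q.2) :=
          hK.comp (by fun_prop)
        exact this.lintegral_prod_right'
    _ = ∫⁻ s in Ioc 0 ρ, ∫⁻ p in B, ∫⁻ w, K (w, s, p) ∂σ := by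
        refine lintegral_congr fun s => lintegral_lintegral_swap (Measurable.aemeasurable ?_)
        exact hK.comp (g := K) (f := fun q : ES n × ES n => (q.1, s, q.2)) (by fun_prop)
    _ ≤ ∫⁻ _ in Ioc 0 ρ, ∫⁻ p in B, ENNReal.ofReal (M * lap V p) := by
        refine setLIntegral_mono' measurableSet_Ioc fun s hs =>
          setLIntegral_mono' measurableSet_closedBall fun p hp => ?_
        have : ∀ w, K (w, s, p) = (closedBall p s).indicator
            (fun _ => ENNReal.ofReal ((s ^ n)⁻¹ * lap V p)) w := fun w => by
          simp only [K, indicator, mem_ofPred_eq, mem_closedBall, dist_comm]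
        simp only [this]
        rw [lintegral_indicator measurableSet_closedBall, setLIntegral_const]
        refine (mul_le_mul_right (hgrowth p s hs.1 hs.2) _).trans_eq ?_
        have hs0 : 0 < s ^ n := pow_pos hs.1 n
        rw [← ENNReal.ofReal_mul (mul_nonneg (inv_nonneg.2 hs0.le) (hD p hp))]
        congr 1
        field_simp
    _ = _ := by
        rw [setLIntegral_const, Real.volume_Ioc, sub_zero, ← ofReal_integral_eq_lintegral_ofReal
          (integrableOn_closedBall_of_continuous (by fun_prop) _ _)
          ((ae_restrict_iff' measurableSet_closedBall).2 (Filter.Eventually.of_forall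
            fun q hq => mul_nonneg hM (hD q hq))), ← ENNReal.ofReal_mul' hρ.le,
          integral_const_mul]
        congr 1
        ring

lemma kernelMass_mul_sub_kernelMean {V : ES n → ℝ} (hV : Continuous V) (m : ℝ) (p : ES n) (s : ℝ) :
    kernelMass n * m - kernelMean V p s =
      ∫ z in closedBall (0 : ES n) 1, (m - V (p + s • z)) * meanKernel z := by
  have h1 : Continuous fun z => V (p + s • z) * meanKernel z := by
    have := continuous_meanKernel (n := n)
    fun_prop
  simp only [sub_mul]
  rw [integral_sub (integrableOn_meanKernel.const_mul m)
    (integrableOn_closedBall_of_continuous h1 _ _), integral_const_mul, mul_comm]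
  rfl

lemma le_meanKernel {z : ES n} (hz : z ∈ closedBall (0 : ES n) (3 / 8)) :
    2 * Real.smoothTransition (55 / 64) ≤ meanKernel z := by
  rw [mem_closedBall, dist_zero_right] at hz
  refine mul_le_mul_of_nonneg_left (Real.smoothTransition.monotone ?_) zero_le_two
  nlinarith [norm_nonneg z]

lemma le_bump {z : ES n} (hz : z ∈ closedBall (0 : ES n) (3 / 4)) : ramp (7 / 16) ≤ bump z := by
  rw [mem_closedBall, dist_zero_right] at hz
  refine monotone_ramp ?_
  nlinarith [norm_nonneg z]

lemma le_lapRemainder {V : ES n → ℝ} (hV : ContDiff ℝ 2 V) {z₀ y : ES n} {ρ : ℝ} (hρ : 0 < ρ)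
    (hy : y ∈ ball z₀ ρ) (hD : ∀ q ∈ closedBall y (8 * ρ), 0 ≤ lap V q) :
    4 * ρ * (ramp (7 / 16) * (((8 * ρ) ^ n)⁻¹ * ∫ q in closedBall z₀ (2 * ρ), lap V q)) ≤
      lapRemainder V y (8 * ρ) := by
  have hlc := continuous_lap hV
  have hy' := mem_ball'.1 hy
  set N := ∫ q in closedBall z₀ (2 * ρ), lap V q with hN
  have hN0 : 0 ≤ N := setIntegral_nonneg measurableSet_closedBall fun q hq =>
    hD q (closedBall_subset_closedBall' (by linarith) hq)
  have hc := continuous_integral_lap_mul_bump hV y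
  rw [lapRemainder, ← intervalIntegral.integral_add_adjacent_intervals
    (hc.intervalIntegrable 0 (4 * ρ)) (hc.intervalIntegrable (4 * ρ) (8 * ρ))]
  have h1 : 0 ≤ ∫ s in (0 : ℝ)..4 * ρ,
      s * ∫ z in closedBall (0 : ES n) 1, lap V (y + s • z) * bump z :=
    intervalIntegral.integral_nonneg (by positivity) fun s hs =>
      lapRemainder_integrand_nonneg hD hs.1 (by linarith [hs.2])
  refine le_add_of_nonneg_of_le h1 ?_
  have h2 : 4 * ρ * (ramp (7 / 16) * (((8 * ρ) ^ n)⁻¹ * N)) =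
      ∫ _ in (4 * ρ)..(8 * ρ), ramp (7 / 16) * (((8 * ρ) ^ n)⁻¹ * N) := by
    rw [intervalIntegral.integral_const, smul_eq_mul]
    ring
  rw [h2]
  refine intervalIntegral.integral_mono_on (by linarith)
    intervalIntegrable_const (hc.intervalIntegrable _ _) fun s hs => ?_
  have hs0 : 0 < s := by linarith [hs.1]
  have h3 := mul_le_mul_of_nonneg_left (le_integral_comp_smul_mul (p := y) hlc continuous_bump hs0
    (by norm_num : (0 : ℝ) ≤ 3 / 4) (by norm_num)
    (fun q hq => hD q (closedBall_subset_closedBall hs.2 hq)) bump_nonneg fun z hz => le_bump hz)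
    hs0.le
  refine le_trans ?_ h3
  have h4 : N ≤ ∫ q in closedBall y (s * (3 / 4)), lap V q := by
    refine setIntegral_mono_set (integrableOn_closedBall_of_continuous hlc _ _) ?_
      (closedBall_subset_closedBall' (by linarith [hs.1])).eventuallyLE
    exact (ae_restrict_iff' measurableSet_closedBall).2 (Filter.Eventually.of_forall
      fun q hq => hD q (closedBall_subset_closedBall (by linarith [hs.2]) hq))
  have h5 : ((8 * ρ) ^ n)⁻¹ ≤ (s ^ n)⁻¹ := by gcongr; exact hs.2
  have hr := ramp_nonneg (7 / 16)
  calc ramp (7 / 16) * (((8 * ρ) ^ n)⁻¹ * N)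
      ≤ ramp (7 / 16) * ((s ^ n)⁻¹ * ∫ q in closedBall y (s * (3 / 4)), lap V q) := by gcongr
    _ = _ := by
      have := hs0.ne'
      field_simp
      ring

lemma IsADR.restrict_closedBall_le {C : ℝ} {E : Set (ES n)} (hE : IsADR n C E) {ρ : ℝ}
    (hd : ENNReal.ofReal (3 * ρ) < EMetric.diam E) (B : Set (ES n))
    (p : ES n) {s : ℝ} (hs : 0 < s) (hsρ : s ≤ ρ) :
    (μH[(n : ℝ)]).restrict (E ∩ B) (closedBall p s) ≤ ENNReal.ofReal (C * 3 ^ n * s ^ n) := by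
  rw [Measure.restrict_apply measurableSet_closedBall]
  rcases (closedBall p s ∩ (E ∩ B)).eq_empty_or_nonempty with h | ⟨w, hw, hwE, -⟩
  · simp [h]
  · refine (measure_mono (t := E ∩ ball w (3 * s)) ?_).trans ((hE.2.2 w hwE (3 * s) (by linarith)
      ((ENNReal.ofReal_le_ofReal (by linarith)).trans_lt hd)).2.trans_eq ?_)
    · rintro q ⟨hq, hqE, -⟩
      refine ⟨hqE, ?_⟩
      rw [mem_closedBall] at hq
      rw [mem_closedBall'] at hw
      rw [mem_ball]
      linarith [dist_triangle q p w]
    · rw [mul_pow, mul_assoc]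

/-- The contraction factor for the decay of subharmonic functions vanishing on an ADR set. -/
lemma exists_decay_factor (n : ℕ) (C : ℝ) :
    ∃ θ : ℝ, 1 / 10 ≤ θ ∧ θ < 1 ∧ ∀ E : Set (ES n), IsADR n C E → ∀ V : ES n → ℝ,
      ContDiff ℝ 2 V → ∀ z₀ ∈ E, ∀ ρ : ℝ, 0 < ρ → ENNReal.ofReal (3 * ρ) < EMetric.diam E →
      ∀ m : ℝ, (∀ q ∈ ball z₀ (10 * ρ), V q ≤ m) →
      (∀ q ∈ ball z₀ (10 * ρ), 0 ≤ lap V q) → (∀ q ∈ E ∩ ball z₀ (10 * ρ), V q = 0) →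
      ∀ y ∈ ball z₀ ρ, V y ≤ θ * m := by
  by_cases hC : 1 ≤ C
  swap
  · exact ⟨1 / 10, le_rfl, by norm_num, fun E hE => absurd hE.2.1 hC⟩
  have hC0 : 0 < C := by linarith
  set c₀ := 2 * Real.smoothTransition (55 / 64) with hc₀
  set c₁ := ramp (7 / 16) with hc₁
  have hc₀p : 0 < c₀ := mul_pos two_pos (Real.smoothTransition.pos_of_pos (by norm_num))
  have hc₁p : 0 < c₁ := ramp_pos (by norm_num)
  set a := c₀ / (4 * 8 ^ (n + 1)) with ha
  set b := 2 * c₁ / (8 ^ n * (C ^ 2 * 3 ^ n)) with hb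
  have hap : 0 < a := by positivity
  have hbp : 0 < b := by positivity
  refine ⟨max (1 / 10) (1 - min a b), le_max_left _ _,
    max_lt (by norm_num) (by linarith [lt_min hap hbp]), ?_⟩
  intro E hE V hV z₀ hz₀ ρ hρ hd m hm hD hz y hy
  have hκ := kernelMass_pos n
  set κ := kernelMass n
  have hm0 : 0 ≤ m := (hz z₀ ⟨hz₀, mem_ball_self (by linarith)⟩).ge.trans
    (hm z₀ (mem_ball_self (by linarith)))
  have hy' := mem_ball.1 hy
  have hy'' := mem_ball'.1 hy
  suffices h : V y ≤ (1 - a) * m ∨ V y ≤ (1 - b) * m by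
    have h1 : (1 - a) * m ≤ max (1 / 10) (1 - min a b) * m := mul_le_mul_of_nonneg_right
      ((sub_le_sub_left (min_le_left _ _) _).trans (le_max_right _ _)) hm0
    have h2 : (1 - b) * m ≤ max (1 / 10) (1 - min a b) * m := mul_le_mul_of_nonneg_right
      ((sub_le_sub_left (min_le_right _ _) _).trans (le_max_right _ _)) hm0
    rcases h with h | h <;> linarith
  have hmc : Continuous fun q => m - V q := continuous_const.sub hV.continuous
  set I := ∫ q in closedBall z₀ (2 * ρ), (m - V q) with hI
  have hDy (q) (hq : q ∈ closedBall y (8 * ρ)) : 0 ≤ lap V q :=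
    hD q (closedBall_subset_ball' (by linarith) hq)
  have hrep := kernelMean_eq_add_integral_lap hV y (8 * ρ)
  have hrem := le_lapRemainder hV hρ hy hDy
  set N := ∫ q in closedBall z₀ (2 * ρ), lap V q with hN
  have hN0 : 0 ≤ N := setIntegral_nonneg measurableSet_closedBall fun q hq =>
    hD q (closedBall_subset_ball (by linarith) hq)
  have hmean : c₀ * (((8 * ρ) ^ (n + 1))⁻¹ * I) ≤ κ * m - kernelMean V y (8 * ρ) := by
    rw [kernelMass_mul_sub_kernelMean hV.continuous]
    have hpos (q) (hq : q ∈ closedBall y (8 * ρ)) : 0 ≤ m - V q :=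
      sub_nonneg.2 (hm q (closedBall_subset_ball' (by linarith) hq))
    refine le_trans ?_ (le_integral_comp_smul_mul (p := y) hmc continuous_meanKernel
      (by positivity : 0 < 8 * ρ) (by norm_num : (0 : ℝ) ≤ 3 / 8) (by norm_num) hpos
      meanKernel_nonneg fun z hz => le_meanKernel hz)
    have : I ≤ ∫ q in closedBall y (8 * ρ * (3 / 8)), (m - V q) := by
      refine setIntegral_mono_set (integrableOn_closedBall_of_continuous hmc _ _) ?_
        (closedBall_subset_closedBall' (by linarith)).eventuallyLE
      exact (ae_restrict_iff' measurableSet_closedBall).2 (Filter.Eventually.of_forall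
        fun q hq => hpos q (closedBall_subset_closedBall (by linarith) hq))
    gcongr
  have hrem0 : 0 ≤ lapRemainder V y (8 * ρ) := le_trans (by positivity) hrem
  have hrep' : kernelMean V y (8 * ρ) = κ * V y + lapRemainder V y (8 * ρ) := hrep
  rcases le_or_gt (κ * m / 4 * ρ ^ (n + 1)) I with hcase | hcase
  · left
    have h1 : c₀ * (((8 * ρ) ^ (n + 1))⁻¹ * (κ * m / 4 * ρ ^ (n + 1))) ≤
        c₀ * (((8 * ρ) ^ (n + 1))⁻¹ * I) := by gcongr
    have h2 : c₀ * (((8 * ρ) ^ (n + 1))⁻¹ * (κ * m / 4 * ρ ^ (n + 1))) = κ * (a * m) := by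
      rw [ha, mul_pow]
      field_simp
    refine le_of_mul_le_mul_left ?_ hκ
    linarith
  · right
    let σ := (μH[(n : ℝ)] : Measure (ES n)).restrict (E ∩ ball z₀ ρ)
    have hADR := hE.2.2 z₀ hz₀ ρ hρ ((ENNReal.ofReal_le_ofReal (by linarith)).trans_lt hd)
    have : IsFiniteMeasure σ :=
      ⟨by rw [Measure.restrict_apply_univ]; exact hADR.2.trans_lt ENNReal.ofReal_lt_top⟩
    have hA : ∀ᵐ w ∂σ, w ∈ ball z₀ ρ ∧ κ * m / 2 ≤ lapRemainder V w ρ := by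
      refine (ae_restrict_iff' (hE.1.measurableSet.inter measurableSet_ball)).2
        (Filter.Eventually.of_forall fun w hw => ⟨hw.2, ?_⟩)
      have hw' := mem_ball.1 hw.2
      have h1 : kernelMean V w ρ = κ * V w + lapRemainder V w ρ :=
        kernelMean_eq_add_integral_lap hV w ρ
      rw [hz w ⟨hw.1, ball_subset_ball (by linarith) hw.2⟩, mul_zero, zero_add] at h1
      have h2 : κ * m - kernelMean V w ρ ≤ 2 * ((ρ ^ (n + 1))⁻¹ * I) := by
        rw [kernelMass_mul_sub_kernelMean hV.continuous]
        refine (integral_comp_smul_mul_le (p := w) hmc continuous_meanKernel hρ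
          (fun q hq => sub_nonneg.2 (hm q (closedBall_subset_ball' (by linarith) hq)))
          meanKernel_le_two).trans ?_
        have : ∫ q in closedBall w ρ, (m - V q) ≤ I := by
          refine setIntegral_mono_set (integrableOn_closedBall_of_continuous hmc _ _) ?_
            (closedBall_subset_closedBall' (by linarith)).eventuallyLE
          exact (ae_restrict_iff' measurableSet_closedBall).2 (Filter.Eventually.of_forall
            fun q hq => sub_nonneg.2 (hm q (closedBall_subset_ball (by linarith) hq)))
        gcongr
      have h3 : (ρ ^ (n + 1))⁻¹ * I ≤ κ * m / 4 := by
        rw [inv_mul_le_iff₀ (by positivity)]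
        linarith
      linarith
    have hkey := mul_measure_le_integral_lap hV hρ (by positivity : 0 ≤ C * 3 ^ n)
      (fun q hq => hD q (closedBall_subset_ball (by linarith) hq)) σ
      (fun p s hs hsρ => hE.restrict_closedBall_le hd _ p hs hsρ) hA
    have hkey' : κ * m / 2 * (C⁻¹ * ρ ^ n) ≤ C * 3 ^ n * ρ * N := by
      rw [← ENNReal.ofReal_le_ofReal_iff (by positivity), ENNReal.ofReal_mul (by positivity)]
      refine le_trans (mul_le_mul_right ?_ _) hkey
      rw [Measure.restrict_apply_univ]
      exact hADR.1
    have h1 : κ * (b * m) ≤ 4 * ρ * (c₁ * (((8 * ρ) ^ n)⁻¹ * N)) := by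
      calc κ * (b * m) = 4 * c₁ / (8 ^ n * ρ ^ n * (C * 3 ^ n)) * (κ * m / 2 * (C⁻¹ * ρ ^ n)) := by
            rw [hb]; field_simp; ring
        _ ≤ 4 * c₁ / (8 ^ n * ρ ^ n * (C * 3 ^ n)) * (C * 3 ^ n * ρ * N) := by gcongr
        _ = _ := by rw [mul_pow]; field_simp
    have h2 : 0 ≤ c₀ * (((8 * ρ) ^ (n + 1))⁻¹ * I) := by
      have : 0 ≤ I := setIntegral_nonneg measurableSet_closedBall fun q hq =>
        sub_nonneg.2 (hm q (closedBall_subset_ball (by linarith) hq))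
      positivity
    refine le_of_mul_le_mul_left ?_ hκ
    linarith

/-- Boundary Hölder estimate for globally `C²` functions that are nonnegative and subharmonic near
an ADR set on which they vanish. -/
lemma exists_holder_of_contDiff (n : ℕ) (C : ℝ) :
    ∃ K α : ℝ, 0 < K ∧ 0 < α ∧ α ≤ 1 ∧ ∀ E : Set (ES n), IsADR n C E → ∀ V : ES n → ℝ,
      ContDiff ℝ 2 V → ∀ x ∈ E, ∀ r : ℝ, 0 < r → ENNReal.ofReal r < EMetric.diam E →
      (∀ q ∈ ball x (3 / 2 * r), 0 ≤ V q) → (∀ q ∈ ball x (3 / 2 * r), 0 ≤ lap V q) →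
      (∀ q ∈ E ∩ ball x (3 / 2 * r), V q = 0) →
      ∀ Y ∈ ball x r, V Y ≤ K * (infDist Y E / r) ^ α *
        ((r ^ (n + 1))⁻¹ * ∫ q in ball x (3 / 2 * r), V q) := by
  obtain ⟨θ, hθ, hθ1, hdecay⟩ := exists_decay_factor n C
  have hθ0 : 0 < θ := by linarith
  have hκ := kernelMass_pos n
  set κ := kernelMass n
  set α := Real.logb (1 / 10) θ with hα
  have hθα : (1 / 10 : ℝ) ^ α = θ := Real.rpow_logb (by norm_num) (by norm_num) hθ0
  have hα0 : 0 < α := Real.logb_pos_of_base_lt_one (by norm_num) (by norm_num) hθ0 hθ1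
  have hα1 : α ≤ 1 := by
    by_contra! h
    have := Real.rpow_lt_rpow_of_exponent_gt (by norm_num : (0 : ℝ) < 1 / 10) (by norm_num) h
    rw [hθα, Real.rpow_one] at this
    linarith
  set K₀ := 2 * 5 ^ (n + 1) / κ with hK₀
  have hK₀p : 0 < K₀ := by positivity
  refine ⟨80 * K₀, α, by positivity, hα0, hα1, ?_⟩
  intro E hE V hV x hx r hr hd hpos hD hz Y hY
  set J := (r ^ (n + 1))⁻¹ * ∫ q in ball x (3 / 2 * r), V q with hJ
  have hJ0 : 0 ≤ J :=
    mul_nonneg (by positivity) (setIntegral_nonneg measurableSet_ball hpos)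
  have hbound (p) (hp : p ∈ ball x (13 / 10 * r)) : V p ≤ K₀ * J := by
    rw [mem_ball] at hp
    have hsub : closedBall p (r / 5) ⊆ ball x (3 / 2 * r) :=
      closedBall_subset_ball' (by linarith)
    have h1 := kernelMass_mul_le_integral hV (by positivity : 0 < r / 5)
      (fun q hq => hD q (hsub hq)) (fun q hq => hpos q (hsub hq))
    have h2 : ∫ q in closedBall p (r / 5), V q ≤ ∫ q in ball x (3 / 2 * r), V q := by
      refine setIntegral_mono_set
        ((integrableOn_closedBall_of_continuous hV.continuous _ _).mono_set ball_subset_closedBall)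
        ?_ hsub.eventuallyLE
      exact (ae_restrict_iff' measurableSet_ball).2 (Filter.Eventually.of_forall hpos)
    have h3 : κ * V p ≤ κ * (K₀ * J) := by
      calc κ * V p ≤ 2 * (((r / 5) ^ (n + 1))⁻¹ * ∫ q in closedBall p (r / 5), V q) := h1
        _ ≤ 2 * (((r / 5) ^ (n + 1))⁻¹ * ∫ q in ball x (3 / 2 * r), V q) := by gcongr
        _ = _ := by rw [hK₀, hJ, div_pow]; field_simp
    exact le_of_mul_le_mul_left h3 hκ
  have hY' := mem_ball.1 hY
  obtain ⟨z₀, hz₀, hdist⟩ := hE.1.exists_infDist_eq_dist ⟨x, hx⟩ Y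
  rcases (infDist_nonneg (x := Y) (s := E)).eq_or_lt with h0 | h0
  · have hYE : Y ∈ E := (hE.1.mem_iff_infDist_zero ⟨x, hx⟩).2 h0.symm
    rw [hz Y ⟨hYE, ball_subset_ball (by linarith) hY⟩]
    have := infDist_nonneg (x := Y) (s := E)
    positivity
  set δ := infDist Y E with hδ
  have h80 : (80 * (δ / r)) ^ α ≤ 80 * (δ / r) ^ α := by
    rw [Real.mul_rpow (by norm_num) (by positivity)]
    gcongr
    exact Real.rpow_le_self_of_one_le (by norm_num) hα1
  suffices h : V Y ≤ (80 * (δ / r)) ^ α * (K₀ * J) by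
    calc V Y ≤ (80 * (δ / r)) ^ α * (K₀ * J) := h
      _ ≤ (80 * (δ / r) ^ α) * (K₀ * J) := by gcongr
      _ = _ := by ring
  rcases le_or_gt (r / 40) δ with hcase | hcase
  · have h1 : 1 ≤ (80 * (δ / r)) ^ α := by
      refine Real.one_le_rpow ?_ hα0.le
      rw [← mul_div_assoc, le_div_iff₀ hr]
      linarith
    exact (hbound Y (ball_subset_ball (by linarith) hY)).trans
      (le_mul_of_one_le_left (by positivity) h1)
  have hz₀x : dist z₀ x < 41 / 40 * r := by
    have := dist_triangle z₀ Y x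
    rw [dist_comm z₀ Y] at this
    linarith
  have hiter (k : ℕ) : ∀ q ∈ ball z₀ ((1 / 10) ^ k * (r / 4)), V q ≤ θ ^ k * (K₀ * J) := by
    induction k with
    | zero =>
      intro q hq
      rw [pow_zero, one_mul] at hq ⊢
      exact hbound q (ball_subset_ball' (by linarith) hq)
    | succ k ih =>
      have hp : (1 / 10 : ℝ) ^ k ≤ 1 := pow_le_one₀ (by norm_num) (by norm_num)
      have hp0 : 0 < (1 / 10 : ℝ) ^ k := by positivity
      have hpr : (1 / 10 : ℝ) ^ k * (r / 4) ≤ r / 4 := mul_le_of_le_one_left (by linarith) hp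
      have hs : 10 * ((1 / 10 : ℝ) ^ (k + 1) * (r / 4)) = (1 / 10) ^ k * (r / 4) := by
        rw [pow_succ]; ring
      have hsub : ball z₀ (10 * ((1 / 10 : ℝ) ^ (k + 1) * (r / 4))) ⊆ ball x (3 / 2 * r) := by
        rw [hs]; exact ball_subset_ball' (by linarith)
      intro q hq
      rw [pow_succ' θ, mul_assoc]
      refine hdecay E hE V hV z₀ hz₀ _ (by positivity)
        ((ENNReal.ofReal_le_ofReal (by linarith)).trans_lt hd) _ (by rw [hs]; exact ih)
        (fun q hq => hD q (hsub hq)) (fun q hq => hz q ⟨hq.1, hsub hq.2⟩) q hq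
  have hx8 : 8 * (δ / r) ≤ 1 := by
    rw [← mul_div_assoc, div_le_one₀ hr]
    linarith
  obtain ⟨k, hk1, hk2⟩ := exists_nat_pow_near_of_lt_one (by positivity : 0 < 8 * (δ / r)) hx8
    (by norm_num : (0 : ℝ) < 1 / 10) (by norm_num)
  have hYk : Y ∈ ball z₀ ((1 / 10) ^ k * (r / 4)) := by
    rw [mem_ball, ← hdist]
    have : 8 * δ ≤ (1 / 10) ^ k * r := by
      rwa [← mul_div_assoc, div_le_iff₀ hr] at hk2
    linarith
  refine (hiter k Y hYk).trans (mul_le_mul_of_nonneg_right ?_ (by positivity))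
  rw [← hθα, ← Real.rpow_natCast, ← Real.rpow_mul (by norm_num), mul_comm, Real.rpow_mul
    (by norm_num), Real.rpow_natCast]
  refine Real.rpow_le_rpow (by positivity) ?_ hα0.le
  rw [pow_succ] at hk1
  linarith

lemma lap_congr {V W : ES n → ℝ} {p : ES n} (h : V =ᶠ[nhds p] W) : lap V p = lap W p := by
  refine Finset.sum_congr rfl fun i _ => ?_
  have : (fun y => fderiv ℝ V y (EuclideanSpace.single i 1)) =ᶠ[nhds p]
      fun y => fderiv ℝ W y (EuclideanSpace.single i 1) :=
    (h.fderiv (𝕜 := ℝ)).mono fun y hy => by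
      change fderiv ℝ V y _ = fderiv ℝ W y _
      rw [hy]
  rw [this.fderiv_eq]

/-- Composing a harmonic function with a convex function yields a subharmonic function. -/
lemma lap_comp_nonneg {u : ES n → ℝ} {U : Set (ES n)} (hU : IsOpen U) (hu : HarmonicOn u U)
    {g : ℝ → ℝ} (hg : ContDiff ℝ 2 g) (hg' : Monotone (deriv g)) {p : ES n} (hp : p ∈ U) :
    0 ≤ lap (fun y => g (u y)) p := by
  have hdu {y} (hy : y ∈ U) : ContDiffAt ℝ 2 u y := hu.1.contDiffAt (hU.mem_nhds hy)
  have hdg : Differentiable ℝ (deriv g) :=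
    ((contDiff_succ_iff_deriv (n := 1)).1 hg).2.2.differentiable one_ne_zero
  let e (i : Fin (n + 1)) : ES n := EuclideanSpace.single i 1
  have key (i) : fderiv ℝ (fun y => fderiv ℝ (fun y => g (u y)) y (e i)) p (e i) =
      deriv (deriv g) (u p) * (fderiv ℝ u p (e i)) ^ 2 +
        deriv g (u p) * fderiv ℝ (fun y => fderiv ℝ u y (e i)) p (e i) := by
    have h1 : (fun y => fderiv ℝ (fun y => g (u y)) y (e i)) =ᶠ[nhds p]
        fun y => deriv g (u y) * fderiv ℝ u y (e i) := by
      filter_upwards [hU.mem_nhds hp] with y hy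
      have := ((hg.differentiable two_ne_zero (u y)).hasDerivAt.comp_hasFDerivAt y
        ((hdu hy).differentiableAt two_ne_zero).hasFDerivAt).fderiv
      rw [show (fun y => g (u y)) = g ∘ u from rfl, this]
      simp
    have h2 := (hdg (u p)).hasDerivAt.comp_hasFDerivAt p
      ((hdu hp).differentiableAt two_ne_zero).hasFDerivAt
    have h3 : DifferentiableAt ℝ (fun y => fderiv ℝ u y (e i)) p :=
      (((hdu hp).fderiv_right (m := 1) (by norm_num)).differentiableAt one_ne_zero).clm_apply
        (differentiableAt_const _)
    have h4 : HasFDerivAt (fun y => deriv g (u y) * fderiv ℝ u y (e i)) _ p :=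
      h2.mul h3.hasFDerivAt
    rw [h1.fderiv_eq, h4.fderiv]
    simp
    ring
  have hsum : lap (fun y => g (u y)) p =
      ∑ i, deriv (deriv g) (u p) * (fderiv ℝ u p (e i)) ^ 2 := by
    have h0 := hu.2 p hp
    calc lap (fun y => g (u y)) p = _ := Finset.sum_congr rfl fun i _ => key i
      _ = _ := by rw [Finset.sum_add_distrib, ← Finset.mul_sum _ _ (deriv g (u p)), h0, mul_zero,
        add_zero]
  rw [hsum]
  exact Finset.sum_nonneg fun i _ => mul_nonneg hg'.deriv_nonneg (sq_nonneg _)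

lemma hasDerivAt_ramp_comp (L t : ℝ) :
    HasDerivAt (fun t => ramp (L * t - 1)) (L * Real.smoothTransition (L * t - 1)) t := by
  have h : HasDerivAt (fun t => L * t - 1) L t := by
    simpa using ((hasDerivAt_id t).const_mul L).sub_const 1
  rw [mul_comm]
  exact (hasDerivAt_ramp (L * t - 1)).comp t h

lemma monotone_deriv_ramp_comp {L : ℝ} (hL : 0 ≤ L) :
    Monotone (deriv fun t => ramp (L * t - 1)) := by
  rw [funext fun t => (hasDerivAt_ramp_comp L t).deriv]
  intro s t hst
  refine mul_le_mul_of_nonneg_left (Real.smoothTransition.monotone ?_) hL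
  gcongr

/-- A subharmonic `C²` regularization of `L • u`, extended by zero across the boundary of `Ω`. -/
lemma exists_contDiff_regularization {Ω : Set (ES n)} (hΩ : IsOpen Ω) {x : ES n} {r : ℝ}
    (hr : 0 < r) {u : ES n → ℝ} (hpos : ∀ z ∈ Ω ∩ ball x (2 * r), 0 ≤ u z)
    (hu : HarmonicOn u (Ω ∩ ball x (2 * r))) (huc : ContinuousOn u (closure (Ω ∩ ball x (2 * r))))
    (hz : ∀ z ∈ ball x (2 * r) ∩ frontier Ω, u z = 0) {L : ℝ} (hL : 0 < L) :
    ∃ W : ES n → ℝ, ContDiff ℝ 2 W ∧ HasCompactSupport W ∧ (∀ q, 0 ≤ W q) ∧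
      (∀ q, W q ≤ (Ω ∩ ball x (2 * r)).indicator (fun q => L * u q) q) ∧
      (∀ q ∈ ball x (3 / 2 * r), 0 ≤ lap W q) ∧
      (∀ q ∈ Ω ∩ ball x (3 / 2 * r), L * u q - 2 ≤ W q) := by
  set U := Ω ∩ ball x (2 * r) with hUdef
  have hU : IsOpen U := hΩ.inter isOpen_ball
  let g : ℝ → ℝ := fun t => ramp (L * t - 1)
  have hg : ContDiff ℝ 2 g := contDiff_ramp.comp (by fun_prop)
  let χ : ContDiffBump x := ⟨3 / 2 * r, 7 / 4 * r, by positivity, by linarith⟩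
  let G : ES n → ℝ := U.indicator fun q => g (u q)
  have hG0 (q) : 0 ≤ G q := indicator_nonneg (fun q _ => ramp_nonneg _) q
  have hGin (p) (hp : p ∈ U) : G =ᶠ[nhds p] fun q => g (u q) := by
    filter_upwards [hU.mem_nhds hp] with q hq using indicator_of_mem hq _
  have hGout (p) (hp : p ∈ ball x (2 * r)) (hpΩ : p ∉ Ω) : G =ᶠ[nhds p] fun _ => 0 := by
    by_cases hpc : p ∈ closure Ω
    · have hpU : p ∈ closure U := by
        rw [hUdef, inter_comm]
        exact isOpen_ball.inter_closure ⟨hp, hpc⟩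
      have hup : u p = 0 := hz p ⟨hp, hpc, by rwa [hΩ.interior_eq]⟩
      have hlt : ∀ᶠ q in nhdsWithin p (closure U), u q < 1 / L :=
        (huc p hpU).eventually_lt_const (by rw [hup]; positivity)
      filter_upwards [eventually_nhdsWithin_iff.1 hlt] with q hq
      by_cases hqU : q ∈ U
      · have := hq (subset_closure hqU)
        rw [lt_div_iff₀ hL] at this
        rw [show G q = g (u q) from indicator_of_mem hqU _]
        exact ramp_of_nonpos (by linarith)
      · exact indicator_of_notMem hqU _
    · filter_upwards [isClosed_closure.isOpen_compl.mem_nhds hpc] with q hq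
      exact indicator_of_notMem (fun h => hq (subset_closure h.1)) _
  refine ⟨fun q => χ q * G q, ?_, χ.hasCompactSupport.mul_right, ?_, ?_, ?_, ?_⟩
  · rw [contDiff_iff_contDiffAt]
    intro p
    by_cases hp : p ∈ ball x (2 * r)
    · refine (χ.contDiff (n := 2)).contDiffAt.mul ?_
      by_cases hpΩ : p ∈ Ω
      · exact (hg.contDiffAt.comp p (hu.1.contDiffAt (hU.mem_nhds ⟨hpΩ, hp⟩))).congr_of_eventuallyEq
          (hGin p ⟨hpΩ, hp⟩)
      · exact contDiffAt_const.congr_of_eventuallyEq (hGout p hp hpΩ)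
    · refine (contDiffAt_const (c := 0)).congr_of_eventuallyEq ?_
      have hp' : p ∈ (tsupport χ)ᶜ := by
        rw [χ.tsupport_eq, mem_compl_iff, mem_closedBall, not_le]
        rw [mem_ball, not_lt] at hp
        exact lt_of_lt_of_le (by change 7 / 4 * r < 2 * r; linarith) hp
      filter_upwards [(isClosed_tsupport χ).isOpen_compl.mem_nhds hp'] with q hq
      rw [image_eq_zero_of_notMem_tsupport hq, zero_mul]
  · exact fun q => mul_nonneg χ.nonneg (hG0 q)
  · intro q
    refine (mul_le_of_le_one_left (hG0 q) χ.le_one).trans ?_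
    by_cases hq : q ∈ U
    · rw [show G q = g (u q) from indicator_of_mem hq _, indicator_of_mem hq]
      exact (monotone_ramp (by linarith)).trans (ramp_le_self (mul_nonneg hL.le (hpos q hq)))
    · rw [show G q = 0 from indicator_of_notMem hq _, indicator_of_notMem hq]
  · intro p hp
    have hpb : p ∈ ball x (2 * r) := ball_subset_ball (by linarith) hp
    have h1 : (fun q => χ q * G q) =ᶠ[nhds p] G := by
      filter_upwards [χ.eventuallyEq_one_of_mem_ball hp] with q hq
      rw [hq, Pi.one_apply, one_mul]
    rw [lap_congr h1]
    by_cases hpΩ : p ∈ Ω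
    · rw [lap_congr (hGin p ⟨hpΩ, hpb⟩)]
      exact lap_comp_nonneg hU hu hg (monotone_deriv_ramp_comp hL.le) ⟨hpΩ, hpb⟩
    · rw [lap_congr (hGout p hpb hpΩ)]
      simp [lap]
  · intro q hq
    have hqU : q ∈ U := ⟨hq.1, ball_subset_ball (by linarith) hq.2⟩
    simp only
    rw [χ.one_of_mem_closedBall (ball_subset_closedBall hq.2), one_mul,
      show G q = g (u q) from indicator_of_mem hqU _]
    linarith [sub_one_le_ramp (L * u q - 1)]

/-- boundary Hölder continuity. If `∂Ω` is `n`-dimensional ADR and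
`u ≥ 0` is harmonic in `Ω ∩ B(x,2r)`, continuous up to the boundary and vanishing on
`Δ(x,2r)`, then `u(Y) ≤ C (δ(Y)/r)^α |B(x,2r)|⁻¹ ∬_{B(x,2r)∩Ω} u` for `Y ∈ B(x,r) ∩ Ω`,
with `C, α` depending only on `n` and the ADR constant. -/
theorem boundary_holder (n : ℕ) (C_ADR : ℝ) :
    ∃ C α : ℝ, 0 < C ∧ 0 < α ∧ α ≤ 1 ∧
      ∀ Ω : Set (ES n), IsOpen Ω → IsADR n C_ADR (frontier Ω) →
      ∀ x ∈ frontier Ω, ∀ r : ℝ, 0 < r → ENNReal.ofReal r < EMetric.diam (frontier Ω) →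
      ∀ u : ES n → ℝ,
        (∀ z ∈ Ω ∩ ball x (2 * r), 0 ≤ u z) →
        HarmonicOn u (Ω ∩ ball x (2 * r)) →
        ContinuousOn u (closure (Ω ∩ ball x (2 * r))) →
        (∀ z ∈ ball x (2 * r) ∩ frontier Ω, u z = 0) →
      ∀ Y ∈ ball x r ∩ Ω,
        u Y ≤ C * (Metric.infDist Y (frontier Ω) / r) ^ α *
          ((volume (ball x (2 * r))).toReal)⁻¹ * ∫ z in ball x (2 * r) ∩ Ω, u z := by
  obtain ⟨K, α, hK, hα0, hα1, hmain⟩ := exists_holder_of_contDiff n C_ADR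
  set ω := (volume (ball (0 : ES n) 1)).toReal with hω
  have hωp : 0 < ω :=
    ENNReal.toReal_pos (measure_ball_pos volume _ one_pos).ne' measure_ball_lt_top.ne
  refine ⟨K * (2 ^ (n + 1) * ω), α, by positivity, hα0, hα1, ?_⟩
  intro Ω hΩ hADR x hx r hr hd u hpos hu huc hz Y hY
  have hvol : (volume (ball x (2 * r))).toReal = 2 ^ (n + 1) * r ^ (n + 1) * ω := by
    rw [Measure.addHaar_ball_of_pos volume x (by positivity : 0 < 2 * r), ENNReal.toReal_mul,
      ENNReal.toReal_ofReal (by positivity), finrank_euclideanSpace_fin, mul_pow]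
  have hui : IntegrableOn u (Ω ∩ ball x (2 * r)) :=
    (huc.integrableOn_compact (isBounded_ball.subset inter_subset_right).isCompact_closure).mono_set
      subset_closure
  have hUm : MeasurableSet (Ω ∩ ball x (2 * r)) := (hΩ.inter isOpen_ball).measurableSet
  have hδ := infDist_nonneg (x := Y) (s := frontier Ω)
  have hconst : K * (2 ^ (n + 1) * ω) * (infDist Y (frontier Ω) / r) ^ α *
      ((volume (ball x (2 * r))).toReal)⁻¹ =
      K * (infDist Y (frontier Ω) / r) ^ α * (r ^ (n + 1))⁻¹ := by
    rw [hvol]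
    field_simp
  rw [hconst, inter_comm (ball x (2 * r))]
  set c := K * (infDist Y (frontier Ω) / r) ^ α with hc
  have hc0 : 0 ≤ c := by positivity
  refine le_of_forall_pos_le_add fun ε hε => ?_
  obtain ⟨W, hW, hWc, hW0, hWle, hlap, hWge⟩ :=
    exists_contDiff_regularization hΩ hr hpos hu huc hz (by positivity : 0 < 2 / ε)
  have h1 := hmain (frontier Ω) hADR W hW x hx r hr hd (fun q _ => hW0 q) hlap (fun q hq => by
    refine le_antisymm ((hWle q).trans_eq (indicator_of_notMem (fun h => ?_) _)) (hW0 q)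
    exact hq.1.2 (by rw [hΩ.interior_eq]; exact h.1)) Y hY.1
  have h2 : ∫ q in ball x (3 / 2 * r), W q ≤ 2 / ε * ∫ q in Ω ∩ ball x (2 * r), u q := by
    have hWi : Integrable W := hW.continuous.integrable_of_hasCompactSupport hWc
    rw [← integral_const_mul, ← integral_indicator hUm]
    exact (setIntegral_le_integral hWi (Filter.Eventually.of_forall hW0)).trans
      (integral_mono hWi ((integrable_indicator_iff hUm).2 (hui.const_mul _)) hWle)
  have h3 := hWge Y ⟨hY.2, ball_subset_ball (by linarith) hY.1⟩
  have h4 : 2 / ε * u Y - 2 ≤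
      c * ((r ^ (n + 1))⁻¹ * (2 / ε * ∫ q in Ω ∩ ball x (2 * r), u q)) :=
    (h3.trans h1).trans (by gcongr)
  have h5 : 2 / ε * u Y ≤
      2 / ε * (c * (r ^ (n + 1))⁻¹ * (∫ q in Ω ∩ ball x (2 * r), u q) + ε) := by
    have : 2 / ε * ε = 2 := by field_simp
    linarith
  exact le_of_mul_le_mul_left h5 (by positivity)
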